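/- In a unital C*-algebra of stable rank one, a positive element a is Cuntz equivalent to a projection if and only if 0 is either not in the spectrum of a or is an isolated point of the spectrum of a. -/

import Mathlib

open Filter

/-- Cuntz subequivalence: `a ≾ b` iff there is a sequence `rₙ` with `rₙ* b rₙ → a` in norm. -/
def CuntzSubequiv {A : Type*} [NormedRing A] [StarRing A] (a b : A) : Prop :=
  ∃ r : ℕ → A, Filter.Tendsto (fun n => star (r n) * b * r n) Filter.atTop (nhds a)

/-- Cuntz equivalence: mutual Cuntz subequivalence. -/
def CuntzEquiv {A : Type*} [NormedRing A] [StarRing A] (a b : A) : Prop :=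
  CuntzSubequiv a b ∧ CuntzSubequiv b a

/-- If the invertible elements of a complete normed ring are dense, then every left
invertible element is invertible. -/
theorem isUnit_of_dense_isUnit_of_isUnit_mul {A : Type*} [NormedRing A] [CompleteSpace A]
    (hA : Dense {x : A | IsUnit x}) {l u : A} (h : IsUnit (l * u)) : IsUnit u := by
  have hopen : IsOpen {c : A | IsUnit (c * u)} :=
    Units.isOpen.preimage (continuous_id.mul continuous_const)
  obtain ⟨c, hc, hcu⟩ := hA.inter_open_nonempty _ hopen ⟨l, h⟩
  exact (IsUnit.mul_left_iff hcu).mp hc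

/-- In a C⋆-algebra of stable rank one, an element Cuntz equivalent to a projection is von Neumann
regular. -/
theorem CuntzEquiv.exists_eq_mul_mul_self {A : Type*} [CStarAlgebra A]
    (hA : Dense {x : A | IsUnit x}) {a p : A} (hp : IsSelfAdjoint p) (hpp : IsIdempotentElem p)
    (h : CuntzEquiv a p) : ∃ c : A, a = a * c * a := by
  obtain ⟨⟨s, hs⟩, ⟨r, hr⟩⟩ := h
  have hpp' : ∀ b : A, p * (p * b) = p * b := fun b => by rw [← mul_assoc, hpp.eq]
  have hunit : ∃ x : A, x * p = x ∧ IsUnit (star x * a * x + (1 - p)) := by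
    have hlim : Tendsto (fun n => star (r n * p) * a * (r n * p) + (1 - p)) atTop (nhds 1) := by
      have := ((hr.const_mul p).mul_const p).add_const (1 - p)
      rw [hpp.eq, hpp.eq, add_sub_cancel] at this
      refine this.congr fun n => ?_
      simp only [star_mul, hp.star_eq, mul_assoc]
    obtain ⟨n, hn⟩ := (hlim.eventually (Units.isOpen.mem_nhds isUnit_one)).exists
    exact ⟨r n * p, by rw [mul_assoc, hpp.eq], hn⟩
  obtain ⟨x, hxp, hx⟩ := hunit
  set g := star x * a * x + (1 - p) with hg
  set U : ℕ → A := fun n => p * s n * x + (1 - p) with hU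
  have hUstar : ∀ n, star (U n) = star x * star (s n) * p + (1 - p) := fun n => by
    simp [hU, hp.star_eq, mul_assoc]
  have hUU : ∀ n, star (U n) * U n = star x * (star (s n) * p * s n) * x + (1 - p) := fun n => by
    rw [hUstar, hU]
    simp only [add_mul, mul_add, sub_mul, mul_sub, mul_assoc, hpp', hpp.eq, one_mul, mul_one]
    abel
  have hUy : ∀ n, star (U n) * (p * s n) = star x * (star (s n) * p * s n) := fun n => by
    rw [hUstar]
    simp only [add_mul, sub_mul, mul_assoc, hpp', one_mul]
    abel
  have hyU : ∀ n, star (s n) * p * U n = star (s n) * p * s n * x := fun n => by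
    rw [hU]
    simp only [mul_add, mul_sub, mul_assoc, hpp', hpp.eq, mul_one]
    abel
  have hUUlim : Tendsto (fun n => star (U n) * U n) atTop (nhds g) := by
    simp only [hUU]
    exact ((hs.const_mul _).mul_const _).add_const _
  have hinv : Tendsto (fun n => Ring.inverse (star (U n) * U n)) atTop
      (nhds (Ring.inverse g)) := by
    obtain ⟨u, hu⟩ := hx
    rw [← hu] at hUUlim ⊢
    exact (NormedRing.inverse_continuousAt u).tendsto.comp hUUlim
  have hlim := ((hs.mul_const x).mul hinv).mul (hs.const_mul (star x))
  have hev : (fun n => star (s n) * p * s n * x * Ring.inverse (star (U n) * U n) *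
      (star x * (star (s n) * p * s n))) =ᶠ[atTop] fun n => star (s n) * p * s n := by
    filter_upwards [hUUlim.eventually (Units.isOpen.mem_nhds hx)] with n hn
    have hUn : IsUnit (U n) := isUnit_of_dense_isUnit_of_isUnit_mul hA hn
    have hone : U n * Ring.inverse (star (U n) * U n) * star (U n) = 1 := by
      obtain ⟨u, hu⟩ := hUn
      rw [← hu, ← Units.coe_star, ← Units.val_mul, Ring.inverse_unit, ← Units.val_mul,
        ← Units.val_mul]
      simp
    rw [← hyU, ← hUy]
    calc star (s n) * p * U n * Ring.inverse (star (U n) * U n) * (star (U n) * (p * s n))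
        = star (s n) * p * (U n * Ring.inverse (star (U n) * U n) * star (U n)) * (p * s n) := by
          simp only [mul_assoc]
      _ = star (s n) * p * s n := by rw [hone, mul_one, mul_assoc, hpp', mul_assoc]
  refine ⟨x * Ring.inverse g * star x, ?_⟩
  have := tendsto_nhds_unique hs (hlim.congr' hev)
  simpa only [mul_assoc] using this

/-- The nonzero spectrum of a positive von Neumann regular element is bounded away from zero. -/
theorem exists_pos_le_of_mem_spectrum_of_eq_mul_mul_self {A : Type*} [CStarAlgebra A]
    [PartialOrder A] [StarOrderedRing A] {a c : A} (ha : 0 ≤ a) (h : a = a * c * a) :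
    ∃ ε > 0, ∀ t ∈ spectrum ℝ a, t ≠ 0 → ε ≤ t := by
  have hsa : IsSelfAdjoint a := .of_nonneg ha
  have h' : a = a * star c * a := by simpa [hsa.star_eq, mul_assoc] using congrArg star h
  set b := c * a * star c with hb
  have hab : a = star a * b * a := by
    rw [hsa.star_eq]
    calc a = a * c * (a * star c * a) := by rw [← h', ← h]
      _ = a * b * a := by simp only [hb, mul_assoc]
  have hle : a ≤ ‖b‖ • (a * a) := by
    have := CStarAlgebra.star_left_conjugate_le_norm_smul (a := a) (hsa.conjugate c)
    rwa [← hab, hsa.star_eq] at this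
  have hcfc : cfc (fun t : ℝ => t) a ≤ cfc (fun t : ℝ => ‖b‖ * (t * t)) a := by
    rwa [cfc_const_mul _ _ a, cfc_mul _ _ a, cfc_id' ℝ a]
  rw [cfc_le_iff (fun t : ℝ => t) (fun t : ℝ => ‖b‖ * (t * t)) a] at hcfc
  refine ⟨(‖b‖ + 1)⁻¹, by positivity, fun t ht ht0 => ?_⟩
  have htpos : 0 < t := (spectrum_nonneg_of_nonneg ha ht).lt_of_ne' ht0
  rw [inv_le_iff_one_le_mul₀ (by positivity)]
  nlinarith [hcfc t ht, norm_nonneg b]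

/-- A positive element whose nonzero spectrum is bounded away from zero is Cuntz equivalent to
a projection. -/
theorem exists_cuntzEquiv_of_forall_mem_spectrum {A : Type*} [CStarAlgebra A]
    [PartialOrder A] [StarOrderedRing A] {a : A} (ha : 0 ≤ a) {ε : ℝ} (hε : 0 < ε)
    (h : ∀ t ∈ spectrum ℝ a, t ≠ 0 → ε ≤ t) :
    ∃ p : A, IsSelfAdjoint p ∧ IsIdempotentElem p ∧ CuntzEquiv a p := by
  have hsa : IsSelfAdjoint a := .of_nonneg ha
  have hmax : ∀ t : ℝ, max t ε ≠ 0 := fun t => (lt_max_of_lt_right hε).ne'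
  have hcont : Continuous fun t : ℝ => √(max t ε)⁻¹ :=
    ((continuous_id.max continuous_const).inv₀ hmax).sqrt
  have hcont' : Continuous fun t : ℝ => t * (max t ε)⁻¹ :=
    continuous_id.mul ((continuous_id.max continuous_const).inv₀ hmax)
  have hconj : ∀ f g : ℝ → ℝ, Continuous f → Continuous g →
      star (cfc g a) * cfc f a * cfc g a = cfc (fun t => g t * f t * g t) a := fun f g hf hg => by
    rw [(cfc_predicate g a).star_eq, cfc_mul (fun t => g t * f t) g a
      (hg.mul hf).continuousOn hg.continuousOn, cfc_mul g f a hg.continuousOn hf.continuousOn]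
  have hval : ∀ t ∈ spectrum ℝ a, t * (max t ε)⁻¹ = 0 ∧ t = 0 ∨ t * (max t ε)⁻¹ = 1 := by
    intro t ht
    obtain rfl | ht0 := eq_or_ne t 0
    · simp
    · exact .inr (by rw [max_eq_left (h t ht ht0), mul_inv_cancel₀ ht0])
  refine ⟨cfc (fun t : ℝ => t * (max t ε)⁻¹) a, cfc_predicate _ a, ?_, ?_, ?_⟩
  · rw [IsIdempotentElem, ← cfc_mul _ _ a hcont'.continuousOn hcont'.continuousOn]
    refine cfc_congr fun t ht => ?_
    obtain ⟨h0, -⟩ | h1 := hval t ht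
    · simp only [h0, mul_zero]
    · simp only [h1, mul_one]
  · refine ⟨fun _ => cfc (fun t : ℝ => √t) a, tendsto_const_nhds.congr fun _ => ?_⟩
    rw [hconj _ _ hcont' Real.continuous_sqrt]
    refine (cfc_id' ℝ a).symm.trans ?_
    refine cfc_congr fun t ht => ?_
    have ht0 : 0 ≤ t := spectrum_nonneg_of_nonneg ha ht
    obtain ⟨-, rfl⟩ | h1 := hval t ht
    · simp
    · simp only [h1, mul_one, Real.mul_self_sqrt ht0]
  · refine ⟨fun _ => cfc (fun t : ℝ => √(max t ε)⁻¹) a, tendsto_const_nhds.congr fun _ => ?_⟩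
    have := hconj _ _ continuous_id' hcont
    rw [cfc_id' ℝ a] at this
    rw [this]
    refine cfc_congr fun t _ => ?_
    have : 0 ≤ (max t ε)⁻¹ := inv_nonneg.mpr (hε.le.trans (le_max_right _ _))
    simp only [mul_right_comm _ t, Real.mul_self_sqrt this, mul_comm t]

/-- Perera: in a unital C*-algebra of stable rank one, a positive element
`a` is Cuntz equivalent to a projection iff `0` is either not in the spectrum of `a` or is
an isolated point of the spectrum of `a`. -/
theorem stmt12 {A : Type*} [CStarAlgebra A] [PartialOrder A] [StarOrderedRing A]
    (hsr1 : Dense {x : A | IsUnit x})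
    (a : A) (ha : 0 ≤ a) :
    (∃ p : A, IsSelfAdjoint p ∧ IsIdempotentElem p ∧ CuntzEquiv a p) ↔
      ((0 : ℝ) ∉ spectrum ℝ a ∨
        ((0 : ℝ) ∈ spectrum ℝ a ∧ ¬ AccPt (0 : ℝ) (𝓟 (spectrum ℝ a)))) := by
  have hgap : ((0 : ℝ) ∉ spectrum ℝ a ∨
      ((0 : ℝ) ∈ spectrum ℝ a ∧ ¬ AccPt (0 : ℝ) (𝓟 (spectrum ℝ a)))) ↔
      ∃ ε > 0, ∀ t ∈ spectrum ℝ a, t ≠ 0 → ε ≤ t := by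
    have hor : ((0 : ℝ) ∉ spectrum ℝ a ∨
        ((0 : ℝ) ∈ spectrum ℝ a ∧ ¬ AccPt (0 : ℝ) (𝓟 (spectrum ℝ a)))) ↔
        ¬ AccPt (0 : ℝ) (𝓟 (spectrum ℝ a)) := by
      have hmem := fun h : AccPt (0 : ℝ) (𝓟 (spectrum ℝ a)) =>
        (spectrum.isClosed a).closure_subset (mem_closure_iff_clusterPt.mpr h.clusterPt)
      tauto
    rw [hor, accPt_iff_frequently, not_frequently, Metric.eventually_nhds_iff]
    refine exists_congr fun ε => and_congr_right fun _ => ?_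
    simp only [Real.dist_eq, sub_zero, not_and]
    refine ⟨fun h t ht ht0 => ?_, fun h t hlt ht0 ht => ?_⟩
    · by_contra! hlt
      exact h (by rwa [abs_of_nonneg (spectrum_nonneg_of_nonneg ha ht)]) ht0 ht
    · exact (h t ht ht0).not_gt ((le_abs_self t).trans_lt hlt)
  rw [hgap]
  constructor
  · rintro ⟨p, hp, hpp, h⟩
    obtain ⟨c, hc⟩ := h.exists_eq_mul_mul_self hsr1 hp hpp
    exact exists_pos_le_of_mem_spectrum_of_eq_mul_mul_self ha hc
  · rintro ⟨ε, hε, h⟩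
    exact exists_cuntzEquiv_of_forall_mem_spectrum ha hε h
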